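/- The first trace formula: Let A be a finite-dimensional regular weak Hopf algebra over an algebraically closed field k of characteristic 0, let ℓ ∈ A be a non-degenerate left integral, and let λ ∈ A* be the dual left integral (λ⇀ℓ = 1). Then Tr(S²|_A) = ⟨ε_s^{A*}(λ), ε_s(ℓ)⟩, where ε_s^{A*} is the source counital map of the dual weak Hopf algebra A* and ε_s is the source counital map of A. -/

import Mathlib

open TensorProduct

noncomputable section

variable (k : Type*) [Field k] (A : Type*) [Ring A] [Algebra k A]

/-- A weak Hopf algebra structure on the `k`-algebra `A` (Böhm–Szlachányi). -/
structure WeakHopf : Type _ where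
  comul : A →ₗ[k] A ⊗[k] A
  counit : A →ₗ[k] k
  antipode : A →ₗ[k] A
  antipode_bijective : Function.Bijective antipode
  comul_coassoc :
      (TensorProduct.map comul LinearMap.id).comp comul
        = (TensorProduct.assoc k A A A).symm.toLinearMap.comp
            ((TensorProduct.map LinearMap.id comul).comp comul)
  counit_comul_left : ∀ a : A,
      TensorProduct.lid k A (TensorProduct.map counit LinearMap.id (comul a)) = a
  counit_comul_right : ∀ a : A,
      TensorProduct.rid k A (TensorProduct.map LinearMap.id counit (comul a)) = a
  comul_mul : ∀ g h : A, comul (g * h) = comul g * comul h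
  comul_one_left :
      TensorProduct.map comul LinearMap.id (comul 1)
        = (comul 1 ⊗ₜ[k] (1 : A))
            * (TensorProduct.assoc k A A A).symm ((1 : A) ⊗ₜ[k] comul 1)
  comul_one_right :
      TensorProduct.map comul LinearMap.id (comul 1)
        = (TensorProduct.assoc k A A A).symm ((1 : A) ⊗ₜ[k] comul 1)
            * (comul 1 ⊗ₜ[k] (1 : A))
  counit_mul_left : ∀ f g h : A,
      counit (f * g * h)
        = TensorProduct.lift ((LinearMap.mul k k).compl₁₂
            (counit ∘ₗ LinearMap.mulLeft k f) (counit ∘ₗ LinearMap.mulRight k h)) (comul g)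
  counit_mul_right : ∀ f g h : A,
      counit (f * g * h)
        = TensorProduct.lift ((LinearMap.mul k k).compl₁₂
            (counit ∘ₗ LinearMap.mulRight k h) (counit ∘ₗ LinearMap.mulLeft k f)) (comul g)
  antipode_left : ∀ h : A,
      LinearMap.mul' k A (TensorProduct.map LinearMap.id antipode (comul h))
        = TensorProduct.lid k A
            (TensorProduct.map counit LinearMap.id (comul 1 * (h ⊗ₜ[k] (1 : A))))
  antipode_right : ∀ h : A,
      LinearMap.mul' k A (TensorProduct.map antipode LinearMap.id (comul h))
        = TensorProduct.rid k A
            (TensorProduct.map LinearMap.id counit (((1 : A) ⊗ₜ[k] h) * comul 1))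
  antipode_mid : ∀ h : A,
      LinearMap.mul' k A (TensorProduct.map (LinearMap.mul' k A) LinearMap.id
        (TensorProduct.map (TensorProduct.map antipode LinearMap.id) antipode
          (TensorProduct.map comul LinearMap.id (comul h))))
        = antipode h

namespace WeakHopf

variable {k A}
variable (W : WeakHopf k A)

/-- The target counital map `ε_t(h) = ε(1₍₁₎h)1₍₂₎ = (ε ⊗ id)(Δ(1)(h ⊗ 1))`. -/
def εt : A →ₗ[k] A :=
  (TensorProduct.lid k A).toLinearMap
    ∘ₗ TensorProduct.map W.counit LinearMap.id
    ∘ₗ LinearMap.mulLeft k (W.comul 1)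
    ∘ₗ (TensorProduct.mk k A A).flip 1

/-- The source counital map `ε_s(h) = 1₍₁₎ε(h1₍₂₎) = (id ⊗ ε)((1 ⊗ h)Δ(1))`. -/
def εs : A →ₗ[k] A :=
  (TensorProduct.rid k A).toLinearMap
    ∘ₗ TensorProduct.map LinearMap.id W.counit
    ∘ₗ LinearMap.mulRight k (W.comul 1)
    ∘ₗ TensorProduct.mk k A A 1

/-- The target base `A_t = ε_t(A)`. -/
def targetBase : Submodule k A := LinearMap.range W.εt

/-- The source base `A_s = ε_s(A)`. -/
def sourceBase : Submodule k A := LinearMap.range W.εs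

/-- The minimal weak Hopf subalgebra, generated by `A_s` and `A_t`. -/
def minimalSub : Subalgebra k A :=
  Algebra.adjoin k ((W.targetBase : Set A) ∪ (W.sourceBase : Set A))

/-- `A` is regular if `S²` is the identity on `A_min`. -/
def Regular : Prop := ∀ x ∈ W.minimalSub, W.antipode (W.antipode x) = x

/-- `A` is connected if `Z(A) ∩ A_t = k·1`. -/
def Connected : Prop :=
  ∀ a : A, (a ∈ Subalgebra.center k A ∧ a ∈ W.targetBase) ↔ ∃ c : k, a = c • (1 : A)

/-- `A` is coconnected if `A_s ∩ A_t = k·1`. -/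
def Coconnected : Prop :=
  ∀ a : A, (a ∈ W.sourceBase ∧ a ∈ W.targetBase) ↔ ∃ c : k, a = c • (1 : A)

def Biconnected : Prop := W.Connected ∧ W.Coconnected

/-- A left integral: `hℓ = ε_t(h)ℓ` for all `h`. -/
def IsLeftIntegral (ℓ : A) : Prop := ∀ h : A, h * ℓ = W.εt h * ℓ

/-- A right integral: `rh = rε_s(h)` for all `h`. -/
def IsRightIntegral (r : A) : Prop := ∀ h : A, r * h = r * W.εs h

/-- The Sweedler arrow `φ ⇀ a = a₍₁₎⟨φ, a₍₂₎⟩`. -/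
def harpoon (φ : Module.Dual k A) : A →ₗ[k] A :=
  (TensorProduct.rid k A).toLinearMap
    ∘ₗ TensorProduct.map LinearMap.id φ
    ∘ₗ W.comul

/-- An integral `ℓ` is non-degenerate if `φ ↦ φ ⇀ ℓ` is injective. -/
def IsNondegenerateIntegral (ℓ : A) : Prop :=
  Function.Injective fun φ : Module.Dual k A => W.harpoon φ ℓ

/-- The convolution product on the dual: `(φψ)(h) = φ(h₍₁₎)ψ(h₍₂₎)`. -/
def conv (φ ψ : Module.Dual k A) : Module.Dual k A :=
  TensorProduct.lift ((LinearMap.mul k k).compl₁₂ φ ψ) ∘ₗ W.comul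

/-- The canonical left integral `λ ∈ A*`, `λ(h) = Tr(L_h ∘ S²)`. -/
def canonicalLambda : Module.Dual k A :=
  (LinearMap.trace k A)
    ∘ₗ (LinearMap.llcomp k A A A).flip (W.antipode ∘ₗ W.antipode)
    ∘ₗ (LinearMap.mul k A)

/-- The target counital map of the dual weak Hopf algebra: `ε̂_t(φ) = φ ∘ ε_t`. -/
def dualCounitalTarget (φ : Module.Dual k A) : Module.Dual k A := φ ∘ₗ W.εt

/-- The source counital map of the dual weak Hopf algebra: `ε̂_s(φ) = φ ∘ ε_s`. -/
def dualCounitalSource (φ : Module.Dual k A) : Module.Dual k A := φ ∘ₗ W.εs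

/-- The map `a ↦ e(a₍₁₎)a₍₂₎`; left convolution by `e` on `A*` is precomposition
with this map. -/
def coactL (e : Module.Dual k A) : A →ₗ[k] A :=
  (TensorProduct.lid k A).toLinearMap ∘ₗ TensorProduct.map e LinearMap.id ∘ₗ W.comul

/-- A group-like element: invertible with `Δ(g) = (g⊗g)Δ(1) = Δ(1)(g⊗g)`. -/
def IsGroupLike (g : A) : Prop :=
  IsUnit g ∧ W.comul g = (g ⊗ₜ[k] g) * W.comul 1 ∧ W.comul g = W.comul 1 * (g ⊗ₜ[k] g)

/-- A pivotal element: a group-like `G` with `S²(h) = GhG⁻¹`, i.e. `S²(h)G = Gh`. -/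
def IsPivotal (g : A) : Prop :=
  W.IsGroupLike g ∧ ∀ h : A, W.antipode (W.antipode h) * g = g * h

/-- A trivial group-like element: `g = yS(y)⁻¹` for invertible `y ∈ A_s`
(note `S(y)⁻¹ = S(y⁻¹)`). -/
def IsTrivialGroupLike (g : A) : Prop :=
  ∃ y yi : A, y ∈ W.sourceBase ∧ y * yi = 1 ∧ yi * y = 1 ∧ g = y * W.antipode yi

/-- The character of the trivial `A`-module `A_t`, `h · z = ε_t(hz)`. -/
def trivialChar : A → k := fun h =>
  LinearMap.trace k W.targetBase
    ((W.εt ∘ₗ LinearMap.mulLeft k h).restrict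
      (p := W.targetBase) (q := W.targetBase) (fun x _ => ⟨h * x, rfl⟩))

end WeakHopf

/-- The Wedderburn data of a finite-dimensional semisimple algebra: a complete family
of primitive central idempotents `z j`, together with the matrix sizes `d j`
(so that `(d j)² = dim_k (z j · A)`, i.e. the block `z j · A ≅ M_{d j}(k)`). -/
structure WedderburnData (n : ℕ) : Type _ where
  z : Fin n → A
  d : Fin n → ℕ
  central : ∀ j, z j ∈ Subalgebra.center k A
  idem : ∀ j, z j * z j = z j
  nonzero : ∀ j, z j ≠ 0
  primitive : ∀ (j : Fin n) (q r : A), q ∈ Subalgebra.center k A →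
      r ∈ Subalgebra.center k A → q * q = q → r * r = r → q * r = 0 →
      q + r = z j → q = 0 ∨ r = 0
  orthogonal : ∀ i j, i ≠ j → z i * z j = 0
  total : ∑ j, z j = 1
  d_sq : ∀ j, (d j) ^ 2 = Module.finrank k (LinearMap.range (LinearMap.mulLeft k (z j)))

/-- The irreducible characters of a finite-dimensional semisimple algebra: the character
of the simple module corresponding to the block `z j · A` is
`χ_j(h) = Tr(L_{z_j h} | A) / d j`. -/
def WedderburnData.char {k A : Type*} [Field k] [Ring A] [Algebra k A] {n : ℕ}
    (D : WedderburnData k A n) : Fin n → Module.Dual k A := fun j =>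
  (D.d j : k)⁻¹ •
    ((LinearMap.trace k A) ∘ₗ (LinearMap.mul k A) ∘ₗ LinearMap.mulLeft k (D.z j))

/-- Frobenius–Perron data for a semisimple weak Hopf algebra over `ℂ`: the non-negative
integer structure constants of the products of the irreducible characters under
convolution, and the Frobenius–Perron dimensions `f j = FPdim(V_j)` of the simple
modules, i.e. the unique strictly positive solution of `f i · f j = Σ_m N i j m · f m`. -/
structure FPData {A : Type*} [Ring A] [Algebra ℂ A] (W : WeakHopf ℂ A) {n : ℕ}
    (D : WedderburnData ℂ A n) : Type _ where
  N : Fin n → Fin n → Fin n → ℕ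
  conv_char : ∀ i j, W.conv (D.char i) (D.char j) = ∑ m, (N i j m : ℂ) • D.char m
  f : Fin n → ℝ
  f_pos : ∀ j, 0 < f j
  f_mul : ∀ i j, f i * f j = ∑ m, (N i j m : ℝ) * f m

/-- A Frobenius–Perron element of `A_s`: a non-zero `w ∈ Z(A_s)` with strictly positive
eigenvalues such that `χ_{V_j} ⇀ w = FPdim(V_j) • w` for all simple modules `V_j`
(hence for all finite-dimensional modules). -/
def WeakHopf.IsFPElement {A : Type*} [Ring A] [Algebra ℂ A] (W : WeakHopf ℂ A) {n : ℕ}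
    (D : WedderburnData ℂ A n) (F : FPData W D) (w : A) : Prop :=
  w ≠ 0 ∧ w ∈ W.sourceBase ∧ (∀ y ∈ W.sourceBase, w * y = y * w) ∧
  (∀ c ∈ spectrum ℂ w, ∃ r : ℝ, 0 < r ∧ c = (r : ℂ)) ∧
  ∀ j, W.harpoon (D.char j) w = ((F.f j : ℂ)) • w

/-- A duality pairing realizing the weak Hopf algebra `B` as the dual `A*` of the weak
Hopf algebra `A` (so that `B` carries the dual weak Hopf algebra structure:
`⟨φψ, h⟩ = ⟨φ, h₍₁₎⟩⟨ψ, h₍₂₎⟩`, `1_B = ε_A`, `⟨Δφ, g ⊗ h⟩ = ⟨φ, gh⟩`,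
`ε_B(φ) = ⟨φ, 1⟩`, `⟨S_B(φ), h⟩ = ⟨φ, S_A(h)⟩`). -/
structure DualPair {k A B : Type*} [Field k] [Ring A] [Algebra k A] [Ring B] [Algebra k B]
    (W : WeakHopf k A) (W' : WeakHopf k B) : Type _ where
  pair : B →ₗ[k] Module.Dual k A
  bij : Function.Bijective pair
  mul_compat : ∀ φ ψ : B, pair (φ * ψ) = W.conv (pair φ) (pair ψ)
  one_compat : pair 1 = W.counit
  comul_compat : ∀ (φ : B) (g h : A),
      TensorProduct.lift ((LinearMap.mul k k).compl₁₂ (pair.flip g) (pair.flip h))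
          (W'.comul φ) = pair φ (g * h)
  counit_compat : ∀ φ : B, W'.counit φ = pair φ 1
  antipode_compat : ∀ (φ : B) (h : A), pair (W'.antipode φ) h = pair φ (W.antipode h)

namespace WeakHopf

variable {k A : Type*} [Field k] [Ring A] [Algebra k A] (W : WeakHopf k A)

lemma aux_assoc_mul (x y : (A ⊗[k] A) ⊗[k] A) :
    TensorProduct.assoc k A A A (x * y)
      = TensorProduct.assoc k A A A x * TensorProduct.assoc k A A A y :=
  map_mul (Algebra.TensorProduct.assoc k k k A A A) x y

lemma aux_assoc_comul (h : A) :
    TensorProduct.assoc k A A A (TensorProduct.map W.comul LinearMap.id (W.comul h))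
      = TensorProduct.map LinearMap.id W.comul (W.comul h) := by
  have := LinearMap.congr_fun W.comul_coassoc h
  simp only [LinearMap.comp_apply] at this
  rw [this]
  simp

/-- `(id ⊗ Δ)Δ(1) = (1 ⊗ Δ(1))(Δ(1) ⊗ 1)`. -/
lemma aux_one_right :
    TensorProduct.map LinearMap.id W.comul (W.comul 1)
      = ((1 : A) ⊗ₜ[k] W.comul 1) * TensorProduct.assoc k A A A (W.comul 1 ⊗ₜ[k] (1 : A)) := by
  rw [← aux_assoc_comul, W.comul_one_right, aux_assoc_mul]
  simp

/-- `(id ⊗ Δ)Δ(1) = (Δ(1) ⊗ 1)(1 ⊗ Δ(1))`. -/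
lemma aux_one_left :
    TensorProduct.map LinearMap.id W.comul (W.comul 1)
      = TensorProduct.assoc k A A A (W.comul 1 ⊗ₜ[k] (1 : A)) * ((1 : A) ⊗ₜ[k] W.comul 1) := by
  rw [← aux_assoc_comul, W.comul_one_left, aux_assoc_mul]
  simp

/-- contraction `x ⊗ y ⊗ z ↦ ε(y) x ⊗ z`. -/
def ctrMid : A ⊗[k] (A ⊗[k] A) →ₗ[k] A ⊗[k] A :=
  TensorProduct.map LinearMap.id
    ((TensorProduct.lid k A).toLinearMap ∘ₗ TensorProduct.map W.counit LinearMap.id)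

lemma ctrMid_comul (t : A ⊗[k] A) :
    W.ctrMid (TensorProduct.map LinearMap.id W.comul t) = t := by
  induction t with
  | zero => simp
  | add x y hx hy => simp [hx, hy]
  | tmul x y => simp [ctrMid, W.counit_comul_left]

lemma εs_apply (h : A) : W.εs h = TensorProduct.rid k A
    (TensorProduct.map LinearMap.id W.counit (((1 : A) ⊗ₜ[k] h) * W.comul 1)) := rfl

lemma εt_apply (h : A) : W.εt h = TensorProduct.lid k A
    (TensorProduct.map W.counit LinearMap.id (W.comul 1 * (h ⊗ₜ[k] (1 : A)))) := rfl

lemma aux_map_comul_mul (h : A) (t : A ⊗[k] A) :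
    TensorProduct.map LinearMap.id W.comul (((1 : A) ⊗ₜ[k] h) * t)
      = ((1 : A) ⊗ₜ[k] W.comul h) * TensorProduct.map LinearMap.id W.comul t := by
  induction t with
  | zero => simp
  | add x y hx hy => simp [mul_add, hx, hy]
  | tmul x y => simp [W.comul_mul]

lemma comul_mul_one (h : A) : W.comul h * W.comul 1 = W.comul h := by
  rw [← W.comul_mul, mul_one]

lemma comul_one_mul (h : A) : W.comul 1 * W.comul h = W.comul h := by
  rw [← W.comul_mul, one_mul]

/-- `ε_s(h₁) ⊗ h₂ = 1₁ ⊗ h 1₂`. -/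
lemma εs_comul (h : A) :
    TensorProduct.map W.εs LinearMap.id (W.comul h) = ((1 : A) ⊗ₜ[k] h) * W.comul 1 := by
  rw [← W.ctrMid_comul (((1 : A) ⊗ₜ[k] h) * W.comul 1), aux_map_comul_mul, aux_one_right,
    ← mul_assoc, Algebra.TensorProduct.tmul_mul_tmul, comul_mul_one, one_mul]
  generalize W.comul h = t
  induction t with
  | zero => simp
  | add x y hx hy => simp [add_mul, TensorProduct.tmul_add, hx, hy]
  | tmul x y =>
    simp only [TensorProduct.map_tmul, εs_apply, LinearMap.id_apply]
    generalize W.comul 1 = u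
    induction u with
    | zero => simp
    | add a b ha hb => simp [mul_add, TensorProduct.add_tmul, ha, hb]
    | tmul a b => simp [ctrMid, TensorProduct.smul_tmul]

/-- `Δ(ε_t(h)) = (ε_t(h) ⊗ 1)Δ(1)`. -/
lemma comul_εt (h : A) : W.comul (W.εt h) = (W.εt h ⊗ₜ[k] (1 : A)) * W.comul 1 := by
  have key : ∀ t : A ⊗[k] A,
      W.comul (TensorProduct.lid k A
        (TensorProduct.map W.counit LinearMap.id (t * (h ⊗ₜ[k] (1 : A)))))
      = TensorProduct.lid k (A ⊗[k] A)
        (TensorProduct.map (W.counit ∘ₗ LinearMap.mulRight k h) LinearMap.id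
          (TensorProduct.map LinearMap.id W.comul t)) := by
    intro t
    induction t with
    | zero => simp
    | add x y hx hy => simp only [add_mul, map_add, hx, hy]
    | tmul x y => simp
  rw [εt_apply, key, aux_one_left]
  generalize W.comul 1 = t
  suffices H : ∀ s : A ⊗[k] A, TensorProduct.lid k (A ⊗[k] A)
        (TensorProduct.map (W.counit ∘ₗ LinearMap.mulRight k h) LinearMap.id
          (TensorProduct.assoc k A A A (s ⊗ₜ[k] (1 : A)) * ((1 : A) ⊗ₜ[k] t)))
      = ((TensorProduct.lid k A
        (TensorProduct.map W.counit LinearMap.id (s * (h ⊗ₜ[k] (1 : A))))) ⊗ₜ[k] (1 : A)) * t from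
    H t
  intro s
  induction s with
  | zero => simp
  | add x y hx hy => simp only [add_mul, map_add, TensorProduct.add_tmul, hx, hy]
  | tmul x y => simp [← TensorProduct.smul_tmul']

lemma εs_idem (h : A) : W.εs (W.εs h) = W.εs h := by
  -- contraction by `id ⊗ ε ⊗ ε(h ·)`
  let C : A ⊗[k] A →ₗ[k] A := (TensorProduct.rid k A).toLinearMap ∘ₗ
    TensorProduct.map LinearMap.id (W.counit ∘ₗ LinearMap.mulLeft k h)
  have h1 : W.εs h = C (W.comul 1) := by
    rw [εs_apply]
    generalize W.comul 1 = t
    induction t with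
    | zero => simp
    | add x y hx hy => simp only [mul_add, map_add, hx, hy]
    | tmul x y => simp [C]
  have h2 : W.εs (W.εs h)
      = C (W.ctrMid (((1 : A) ⊗ₜ[k] W.comul 1)
          * TensorProduct.assoc k A A A (W.comul 1 ⊗ₜ[k] (1 : A)))) := by
    rw [h1, εs_apply]
    generalize W.comul 1 = t
    suffices H : ∀ s : A ⊗[k] A, TensorProduct.rid k A
      (TensorProduct.map LinearMap.id W.counit (((1 : A) ⊗ₜ[k] C s) * t))
      = C (W.ctrMid (((1 : A) ⊗ₜ[k] s)
          * TensorProduct.assoc k A A A (t ⊗ₜ[k] (1 : A)))) from H t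
    intro s
    induction s with
    | zero => simp
    | add x y hx hy => simp only [add_mul, map_add, TensorProduct.tmul_add, hx, hy]
    | tmul x y =>
      induction t with
      | zero => simp
      | add a b ha hb => simp only [mul_add, map_add, TensorProduct.add_tmul, ha, hb]
      | tmul a b => simp [C, ctrMid, smul_comm (W.counit (h * y)) (W.counit (x * b)) a]
  rw [h2, ← aux_one_right, ctrMid_comul, ← h1]

lemma antipode_mul_εt (h : A) :
    LinearMap.mul' k A (TensorProduct.map W.antipode W.εt (W.comul h)) = W.antipode h := by
  have hεt : W.εt = LinearMap.mul' k A ∘ₗ TensorProduct.map LinearMap.id W.antipode ∘ₗ W.comul := by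
    ext x
    exact (W.antipode_left x).symm
  have e : ∀ t : (A ⊗[k] A) ⊗[k] A,
      LinearMap.mul' k A (TensorProduct.map (LinearMap.mul' k A) LinearMap.id
        (TensorProduct.map (TensorProduct.map W.antipode LinearMap.id) W.antipode t))
      = LinearMap.mul' k A (TensorProduct.map W.antipode
          (LinearMap.mul' k A ∘ₗ TensorProduct.map LinearMap.id W.antipode)
          (TensorProduct.assoc k A A A t)) := by
    intro t
    refine LinearMap.congr_fun (f := LinearMap.mul' k A ∘ₗ TensorProduct.map (LinearMap.mul' k A) LinearMap.id ∘ₗ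
        TensorProduct.map (TensorProduct.map W.antipode LinearMap.id) W.antipode) (g := LinearMap.mul' k A ∘ₗ TensorProduct.map W.antipode
          (LinearMap.mul' k A ∘ₗ TensorProduct.map LinearMap.id W.antipode) ∘ₗ
          (TensorProduct.assoc k A A A).toLinearMap) ?_ t
    ext x y z
    simp [mul_assoc]
  rw [← W.antipode_mid h, e, aux_assoc_comul, hεt]
  generalize W.comul h = t
  induction t with
  | zero => simp
  | add x y hx hy => simp only [map_add, hx, hy]
  | tmul x y => simp

/-- For a left integral, `ℓ₁ ⊗ hℓ₂ = S(h)ℓ₁ ⊗ ℓ₂`. -/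
lemma integral_shift (ℓ : A) (hint : W.IsLeftIntegral ℓ) (h : A) :
    ((1 : A) ⊗ₜ[k] h) * W.comul ℓ = (W.antipode h ⊗ₜ[k] (1 : A)) * W.comul ℓ := by
  -- `P (x ⊗ y) = (S(x) ⊗ 1) Δ(y ℓ)`
  let P : A ⊗[k] A →ₗ[k] A ⊗[k] A := TensorProduct.lift
    ((LinearMap.mul k (A ⊗[k] A)).compl₁₂ ((TensorProduct.mk k A A).flip 1 ∘ₗ W.antipode)
      (W.comul ∘ₗ LinearMap.mulRight k ℓ))
  have hP : ∀ x y, P (x ⊗ₜ y) = (W.antipode x ⊗ₜ[k] (1 : A)) * W.comul (y * ℓ) := by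
    intro x y; simp [P]
  have h1 : P (W.comul h) = (W.antipode h ⊗ₜ[k] (1 : A)) * W.comul ℓ := by
    rw [← W.antipode_mul_εt h]
    generalize W.comul h = t
    induction t with
    | zero => simp
    | add x y hx hy => simp only [map_add, TensorProduct.add_tmul, add_mul, hx, hy]
    | tmul x y =>
      rw [hP, hint y, W.comul_mul, comul_εt, mul_assoc, comul_one_mul, ← mul_assoc]
      simp
  have h2 : P (W.comul h) = ((1 : A) ⊗ₜ[k] h) * W.comul ℓ := by
    have hεs : W.εs = LinearMap.mul' k A ∘ₗ TensorProduct.map W.antipode LinearMap.id ∘ₗ W.comul := by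
      ext x
      exact (W.antipode_right x).symm
    rw [← W.comul_one_mul ℓ, ← mul_assoc, ← εs_comul, hεs]
    have a : P (W.comul h) = TensorProduct.map (LinearMap.mul' k A ∘ₗ
        TensorProduct.map W.antipode LinearMap.id) LinearMap.id
        ((TensorProduct.assoc k A A A).symm
          (TensorProduct.map LinearMap.id W.comul (W.comul h))) * W.comul ℓ := by
      generalize W.comul h = t
      induction t with
      | zero => simp
      | add x y hx hy => simp only [map_add, add_mul, hx, hy]
      | tmul x y =>
        rw [hP, W.comul_mul, ← mul_assoc]
        congr 1
        simp only [TensorProduct.map_tmul, LinearMap.id_apply]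
        generalize W.comul y = s
        induction s with
        | zero => simp
        | add x y hx hy => simp only [map_add, mul_add, TensorProduct.tmul_add, hx, hy]
        | tmul x y => simp
    rw [a, ← aux_assoc_comul, LinearEquiv.symm_apply_apply]
    congr 1
    generalize W.comul h = t
    induction t with
    | zero => simp
    | add x y hx hy => simp only [map_add, hx, hy]
    | tmul x y => simp
  rw [← h1, h2]

/-- The trace of `h ↦ S(x)λ(hy)` summed over a tensor. -/
lemma trace_aux [FiniteDimensional k A] (lam : Module.Dual k A) (t : A ⊗[k] A) (f : A →ₗ[k] A)
    (hf : ∀ h, f h = TensorProduct.rid k A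
      (TensorProduct.map W.antipode lam (((1 : A) ⊗ₜ[k] h) * t))) :
    LinearMap.trace k A f
      = lam (LinearMap.mul' k A (TensorProduct.map W.antipode LinearMap.id t)) := by
  induction t generalizing f with
  | zero =>
    have : f = 0 := by ext h; simp [hf]
    simp [this]
  | tmul x y =>
    have : f = (lam ∘ₗ LinearMap.mulRight k y).smulRight (W.antipode x) := by
      ext h; simp [hf]
    simp [this, LinearMap.trace_smulRight]
  | add x y hx hy =>
    let g : A ⊗[k] A → A →ₗ[k] A := fun t => (TensorProduct.rid k A).toLinearMap ∘ₗ
      TensorProduct.map W.antipode lam ∘ₗ LinearMap.mulRight k t ∘ₗ TensorProduct.mk k A A 1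
    have : f = g x + g y := by ext h; simp [hf, g, mul_add]
    rw [this, map_add, hx (g x) (fun h => rfl), hy (g y) (fun h => rfl)]
    simp

end WeakHopf

/-- **the first trace formula.** If `ℓ` is a non-degenerate left integral
of a finite-dimensional regular weak Hopf algebra and `λ ∈ A*` its dual left integral
(`λ ⇀ ℓ = 1`), then `Tr(S²|_A) = ⟨ε_s^{A*}(λ), ε_s(ℓ)⟩`, where `ε_s^{A*}(φ) = φ ∘ ε_s`
is the source counital map of the dual weak Hopf algebra. -/
theorem stmt_13 {k A : Type*} [Field k] [IsAlgClosed k] [CharZero k]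
    [Ring A] [Algebra k A] [FiniteDimensional k A]
    (W : WeakHopf k A) (hreg : W.Regular)
    (ℓ : A) (hint : W.IsLeftIntegral ℓ) (hnd : W.IsNondegenerateIntegral ℓ)
    (lam : Module.Dual k A)
    (hlam_int : ∀ φ : Module.Dual k A,
        W.conv φ lam = W.conv (W.dualCounitalTarget φ) lam)
    (hdual : W.harpoon lam ℓ = 1) :
    LinearMap.trace k A (W.antipode ∘ₗ W.antipode)
      = W.dualCounitalSource lam (W.εs ℓ) := by
  have hS : ∀ h, W.antipode h = TensorProduct.rid k A
      (TensorProduct.map LinearMap.id lam (((1 : A) ⊗ₜ[k] h) * W.comul ℓ)) := by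
    intro h
    rw [W.integral_shift ℓ hint h]
    have : W.antipode h = W.antipode h * W.harpoon lam ℓ := by rw [hdual, mul_one]
    refine this.trans ?_
    simp only [WeakHopf.harpoon, LinearMap.comp_apply, LinearEquiv.coe_coe]
    clear this
    generalize W.comul ℓ = t
    induction t with
    | zero => simp
    | add x y hx hy => simp only [map_add, mul_add, hx, hy]
    | tmul x y => simp
  rw [W.trace_aux lam (W.comul ℓ) (W.antipode ∘ₗ W.antipode)]
  · simp only [WeakHopf.dualCounitalSource, LinearMap.comp_apply]
    rw [W.εs_idem, W.antipode_right ℓ]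
    rfl
  · intro h
    rw [LinearMap.comp_apply, hS h]
    generalize ((1 : A) ⊗ₜ[k] h) * W.comul ℓ = t
    induction t with
    | zero => simp
    | add x y hx hy => simp only [map_add, hx, hy]
    | tmul x y => simp
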